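/- arXiv:1301.7023 — 7 statements merged into one kernel-verified Lean document; each statement's English description precedes it below -/
import Mathlib

section
/- Let N, K, T be natural numbers with K ≤ N, and let θ be any function from the set of K-element subsets of Fin N to the set of binary vectors Fin T → Bool (θ(S) representing the vector of test outcomes when S is the defective set). Then the success probability of the optimal decoder, namely (1/(N choose K)) · ∑_{S : S.card = K} 1/|{S' : S'.card = K ∧ θ(S') = θ(S)}|, is at most 2^T/(N choose K). (Theorem 3.1.) -/
/-- Summing the reciprocals of the fiber sizes of `f` over its domain counts the values of `f`,
so the sum is at most the size of the codomain. -/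
theorem sum_one_div_card_fiber_le_card {α β : Type*} [Fintype α] [Fintype β] [DecidableEq β]
    (f : α → β) :
    ∑ a, 1 / ((Finset.univ.filter (fun a' => f a' = f a)).card : ℚ) ≤ Fintype.card β := by
  rw [← Finset.sum_fiberwise Finset.univ f]
  calc
    _ ≤ ∑ _b : β, (1 : ℚ) := by
      refine Finset.sum_le_sum fun b _ => ?_
      have h : ∀ a ∈ Finset.univ.filter (fun a => f a = b),
          1 / ((Finset.univ.filter (fun a' => f a' = f a)).card : ℚ) =
            1 / ((Finset.univ.filter (fun a' => f a' = b)).card : ℚ) := by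
        intro a ha
        rw [(Finset.mem_filter.mp ha).2]
      rw [Finset.sum_congr rfl h, Finset.sum_const, nsmul_eq_mul, mul_one_div]
      exact div_self_le_one _
    _ = Fintype.card β := by simp

/-- Theorem 3.1: the success probability of the optimal decoder for group testing
with `N` items, `K` defectives and `T` tests is at most `2^T / (N choose K)`. -/
theorem success_probability_le (N K T : ℕ) (hKN : K ≤ N)
    (θ : {S : Finset (Fin N) // S.card = K} → (Fin T → Bool)) :
    (1 / (N.choose K : ℚ)) *
      ∑ S : {S : Finset (Fin N) // S.card = K},
        1 / ((Finset.univ.filter (fun S' => θ S' = θ S)).card : ℚ)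
    ≤ 2 ^ T / (N.choose K : ℚ) := by
  have h := sum_one_div_card_fiber_le_card θ
  simp only [Fintype.card_fun, Fintype.card_bool, Fintype.card_fin, Nat.cast_pow,
    Nat.cast_ofNat] at h
  rw [one_div_mul_eq_div]
  gcongr
end

section
/- Let (Ω, μ) be a probability space, X : Ω → ℕ an integrable random variable, and M ≥ 1 a real number. If μ{ω : X ω ≤ t} ≤ 2^t / M for every natural number t, then the expectation of X satisfies E[X] ≥ log₂ M − 2. (Inequality (eq:eptbound): any algorithm detecting the defective set with certainty using a random number T of tests has E[T] ≥ log₂(N choose K) − 2.) -/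
open MeasureTheory

/-- A truncated form of `E[X] = ∑ t, μ{X > t}`: the first `n` lower tails of an `ℕ`-valued
random variable bound `n - E[X]` from above. -/
theorem sub_integral_le_sum_measureReal_le {Ω : Type*} [MeasurableSpace Ω]
    (μ : Measure Ω) [IsProbabilityMeasure μ] (X : Ω → ℕ)
    (hX : Integrable (fun ω => (X ω : ℝ)) μ) (n : ℕ) :
    n - ∫ ω, (X ω : ℝ) ∂μ ≤ ∑ t ∈ Finset.range n, μ.real {ω | X ω ≤ t} := by
  have hmeas (t : ℕ) : NullMeasurableSet {ω | X ω ≤ t} μ := by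
    simpa only [Nat.cast_le] using
      nullMeasurableSet_le hX.aemeasurable (aemeasurable_const (b := (t : ℝ)))
  have hint (t : ℕ) : Integrable ({ω | X ω ≤ t}.indicator fun _ => (1 : ℝ)) μ :=
    (integrable_const 1).indicator₀ (hmeas t)
  have hpt (ω : Ω) : (n : ℝ) - X ω ≤
      ∑ t ∈ Finset.range n, {ω | X ω ≤ t}.indicator (fun _ => (1 : ℝ)) ω := by
    induction n with
    | zero => simp
    | succ n ih =>
      rw [Finset.sum_range_succ]
      by_cases hle : X ω ≤ n
      · rw [Set.indicator_of_mem (show ω ∈ {ω | X ω ≤ n} from hle)]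
        push_cast
        linarith
      · have hlt : (n : ℝ) + 1 ≤ X ω := by exact_mod_cast not_le.1 hle
        refine le_trans (b := 0) (by push_cast; linarith) ?_
        exact add_nonneg
          (Finset.sum_nonneg fun t _ => Set.indicator_nonneg (fun _ _ => zero_le_one) ω)
          (Set.indicator_nonneg (fun _ _ => zero_le_one) ω)
  calc (n : ℝ) - ∫ ω, (X ω : ℝ) ∂μ = ∫ ω, ((n : ℝ) - X ω) ∂μ := by
        rw [integral_sub (integrable_const _) hX]
        simp
    _ ≤ ∫ ω, ∑ t ∈ Finset.range n, {ω | X ω ≤ t}.indicator (fun _ => (1 : ℝ)) ω ∂μ :=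
        integral_mono ((integrable_const _).sub hX)
          (integrable_finsetSum _ fun t _ => hint t) hpt
    _ = ∑ t ∈ Finset.range n, μ.real {ω | X ω ≤ t} := by
        rw [integral_finsetSum _ fun t _ => hint t]
        refine Finset.sum_congr rfl fun t _ => ?_
        rw [integral_indicator₀ (hmeas t)]
        simp

/-- Inequality (eq:eptbound): if an `ℕ`-valued random variable `X` satisfies
`μ{X ≤ t} ≤ 2^t / M` for every natural `t`, then `E[X] ≥ log₂ M − 2`. -/
theorem expectation_ge_logb_sub_two {Ω : Type*} [MeasurableSpace Ω]
    (μ : Measure Ω) [IsProbabilityMeasure μ] (X : Ω → ℕ)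
    (hX : Integrable (fun ω => (X ω : ℝ)) μ) (M : ℝ) (hM : 1 ≤ M)
    (h : ∀ t : ℕ, μ {ω | X ω ≤ t} ≤ ENNReal.ofReal (2 ^ t / M)) :
    Real.logb 2 M - 2 ≤ ∫ ω, (X ω : ℝ) ∂μ := by
  have hM0 : 0 < M := by linarith
  set n := ⌊Real.logb 2 M⌋₊
  have hn : Real.logb 2 M < n + 1 := Nat.lt_floor_add_one _
  have hpow : (2 : ℝ) ^ n ≤ M := by
    rw [← Real.rpow_natCast, ← Real.le_logb_iff_rpow_le one_lt_two hM0]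
    exact Nat.floor_le (Real.logb_nonneg one_lt_two hM)
  have hsum : ∑ t ∈ Finset.range n, μ.real {ω | X ω ≤ t} ≤ 1 := by
    calc ∑ t ∈ Finset.range n, μ.real {ω | X ω ≤ t}
        ≤ ∑ t ∈ Finset.range n, (2 : ℝ) ^ t / M :=
          Finset.sum_le_sum fun t _ => ENNReal.toReal_le_of_le_ofReal (by positivity) (h t)
      _ = (2 ^ n - 1) / M := by
          rw [← Finset.sum_div, geom_sum_eq (by norm_num)]
          norm_num
      _ ≤ 1 := by
          rw [div_le_one hM0]
          linarith
  linarith [sub_integral_le_sum_measureReal_le μ X hX n]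
end

section
/- Let K : ℕ → ℕ satisfy 1 ≤ K(N) ≤ N for all N ≥ 1 and (K(N) : ℝ)/N → 0 as N → ∞. Then log₂(N choose K(N)) / (log₂(N choose K(N)) + K(N)) → 1 as N → ∞. (Achievability computation in the proof of Theorem 1.2: the rate of Hwang's algorithm, which uses log₂ binom(N,K) + K tests, tends to 1 when K = o(N).) -/
open Filter

/-- The lower bound `(n / k) ^ k ≤ n.choose k`, with denominators cleared. -/
theorem Nat.pow_le_choose_mul_pow {n k : ℕ} (h : k ≤ n) : n ^ k ≤ n.choose k * k ^ k := by
  induction k generalizing n with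
  | zero => simp
  | succ k ih =>
    obtain ⟨n, rfl⟩ : ∃ m, n = m + 1 := ⟨n - 1, by lia⟩
    have hkn : k ≤ n := by lia
    have hpow : (n + 1) ^ k ≤ n.choose k * (k + 1) ^ k := by
      rcases Nat.eq_zero_or_pos k with rfl | hk
      · simp
      refine Nat.le_of_mul_le_mul_right ?_ (Nat.pow_pos hk : 0 < k ^ k)
      calc (n + 1) ^ k * k ^ k = ((n + 1) * k) ^ k := (mul_pow _ _ _).symm
        _ ≤ (n * (k + 1)) ^ k := Nat.pow_le_pow_left (by nlinarith) k
        _ = n ^ k * (k + 1) ^ k := mul_pow _ _ _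
        _ ≤ (n.choose k * k ^ k) * (k + 1) ^ k := Nat.mul_le_mul_right _ (ih hkn)
        _ = n.choose k * (k + 1) ^ k * k ^ k := by ring
    calc (n + 1) ^ (k + 1) = (n + 1) * (n + 1) ^ k := by ring
      _ ≤ (n + 1) * (n.choose k * (k + 1) ^ k) := Nat.mul_le_mul_left _ hpow
      _ = ((n + 1) * n.choose k) * (k + 1) ^ k := by ring
      _ = ((n + 1).choose (k + 1) * (k + 1)) * (k + 1) ^ k := by
        rw [Nat.add_one_mul_choose_eq]
      _ = (n + 1).choose (k + 1) * (k + 1) ^ (k + 1) := by ring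

theorem Real.mul_logb_div_le_logb_choose {b : ℝ} (hb : 1 < b) {n k : ℕ} (hk : 0 < k)
    (hkn : k ≤ n) : k * Real.logb b ((n : ℝ) / k) ≤ Real.logb b (n.choose k : ℝ) := by
  have hk' : (0 : ℝ) < k := by exact_mod_cast hk
  have hn' : (0 : ℝ) < n := by exact_mod_cast hk.trans_le hkn
  rw [← Real.logb_pow]
  refine Real.logb_le_logb_of_le hb (by positivity) ?_
  rw [div_pow, div_le_iff₀ (by positivity)]
  exact_mod_cast Nat.pow_le_choose_mul_pow hkn

/-- Achievability computation in the proof of Theorem 1.2: if `1 ≤ K(N) ≤ N` and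
`K(N)/N → 0`, then the rate of Hwang's algorithm, which uses
`log₂(N choose K(N)) + K(N)` tests, tends to `1`. -/
theorem hwang_rate_tendsto_one (K : ℕ → ℕ)
    (hK : ∀ N : ℕ, 1 ≤ N → 1 ≤ K N ∧ K N ≤ N)
    (hKo : Tendsto (fun N : ℕ => (K N : ℝ) / (N : ℝ)) atTop (nhds 0)) :
    Tendsto (fun N : ℕ =>
        Real.logb 2 (N.choose (K N) : ℝ) / (Real.logb 2 (N.choose (K N) : ℝ) + (K N : ℝ)))
      atTop (nhds 1) := by
  have hratio : Tendsto (fun N : ℕ => (N : ℝ) / K N) atTop atTop := by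
    have hpos : ∀ᶠ N : ℕ in atTop, (0 : ℝ) < (K N : ℝ) / N := by
      filter_upwards [eventually_ge_atTop 1] with N hN
      have hKN : (0 : ℝ) < K N := by exact_mod_cast (hK N hN).1
      have hN' : (0 : ℝ) < N := by exact_mod_cast hN
      positivity
    refine (tendsto_nhdsWithin_iff.2 ⟨hKo, hpos⟩).inv_tendsto_nhdsGT_zero.congr fun N => ?_
    simp
  have hlog : Tendsto (fun N : ℕ => Real.logb 2 ((N : ℝ) / K N)) atTop atTop :=
    (Real.tendsto_logb_atTop one_lt_two).comp hratio
  have hbound : ∀ᶠ N : ℕ in atTop, 0 < Real.logb 2 (N.choose (K N) : ℝ) ∧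
      (K N : ℝ) / Real.logb 2 (N.choose (K N) : ℝ) ≤ (Real.logb 2 ((N : ℝ) / K N))⁻¹ := by
    filter_upwards [eventually_ge_atTop 1, hlog.eventually_gt_atTop 0] with N hN hl
    have hKN : (0 : ℝ) < K N := by exact_mod_cast (hK N hN).1
    have hle := Real.mul_logb_div_le_logb_choose one_lt_two (hK N hN).1 (hK N hN).2
    have hL := (mul_pos hKN hl).trans_le hle
    refine ⟨hL, ?_⟩
    rwa [div_le_iff₀ hL, inv_mul_eq_div, le_div_iff₀ hl]
  have hzero : Tendsto (fun N : ℕ => (K N : ℝ) / Real.logb 2 (N.choose (K N) : ℝ))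
      atTop (nhds 0) := by
    refine squeeze_zero' ?_ (hbound.mono fun _ h => h.2) hlog.inv_tendsto_atTop
    filter_upwards [hbound] with N h
    exact div_nonneg (Nat.cast_nonneg _) h.1.le
  have hone := (hzero.const_add 1).inv₀ (by norm_num)
  rw [add_zero, inv_one] at hone
  refine hone.congr' ?_
  filter_upwards [hbound] with N h
  rw [one_add_div h.1.ne', inv_div]
end

section
/- Let N ≥ 1 and K ≤ N be natural numbers and set T = K · ⌈log₂ N⌉. There exist an adaptive group testing strategy f with T tests on Fin N and a decoder g : (Fin T → Bool) → Finset (Fin N) such that for every subset D : Finset (Fin N) with D.card = K, g (a(D)) = D. (Theorem 2.2: Repeated Binary Testing is guaranteed to succeed in K⌈log₂ N⌉ ≤ K log₂ N + K tests.) -/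
/-- The answer sequence of an adaptive group testing strategy `f` on defective set `D`:
the `i`-th answer is `true` iff the `i`-th test set (which may depend on the earlier
answers) intersects `D`. -/
def answers {N T : ℕ} (f : (i : Fin T) → ((j : Fin T) → j < i → Bool) → Finset (Fin N))
    (D : Finset (Fin N)) : Fin T → Bool
  | i => decide (D ∩ f i (fun j hj => answers f D j)).Nonempty
termination_by i => i.val
decreasing_by all_goals assumption

/-- A family `F` of candidate defective sets is resolved by `n` adaptive tests if some decision
tree of depth `n` separates its members. -/
def Resolvable {α : Type*} [DecidableEq α] : ℕ → Set (Finset α) → Prop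
  | 0, F => F.Subsingleton
  | n + 1, F => ∃ S : Finset α, ∀ b : Bool, Resolvable n {D ∈ F | decide (D ∩ S).Nonempty = b}

theorem Resolvable.mono {α : Type*} [DecidableEq α] {n : ℕ} {F G : Set (Finset α)} (h : F ⊆ G)
    (hG : Resolvable n G) : Resolvable n F := by
  induction n generalizing F G with
  | zero => exact Set.Subsingleton.anti hG h
  | succ n ih =>
    obtain ⟨S, hS⟩ := hG
    exact ⟨S, fun b => ih (Set.inter_subset_inter_left _ h) (hS b)⟩

theorem Resolvable.empty {α : Type*} [DecidableEq α] (n : ℕ) :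
    Resolvable n (∅ : Set (Finset α)) := by
  induction n with
  | zero => exact Set.subsingleton_empty
  | succ n ih => exact ⟨∅, fun _ => ih.mono (Set.sep_subset _ _)⟩

/-- Binary search: `m` tests find a defective item inside a set `Y` of at most `2 ^ m` items that
contains one. -/
theorem Resolvable.binary_search {α : Type*} [DecidableEq α] {E : Finset α} {k n : ℕ}
    (hE : ∀ y ∉ E, Resolvable n {D | insert y E ⊆ D ∧ D.card = (insert y E).card + k}) (m : ℕ)
    {Y : Finset α} (hY : Y.card ≤ 2 ^ m) (hYE : Disjoint Y E) (hne : Y.Nonempty) :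
    Resolvable (n + m) {D | E ⊆ D ∧ D.card = E.card + (k + 1) ∧ (D ∩ Y).Nonempty} := by
  induction m generalizing Y with
  | zero =>
    obtain ⟨y, rfl⟩ := Finset.card_eq_one.1
      (le_antisymm (by simpa using hY) (Finset.card_pos.2 hne))
    have hy : y ∉ E := Finset.disjoint_singleton_left.1 hYE
    refine (hE y hy).mono ?_
    rintro D ⟨hED, hc, z, hz⟩
    obtain ⟨hzD, hzy⟩ := Finset.mem_inter.1 hz
    obtain rfl := Finset.mem_singleton.1 hzy
    refine ⟨Finset.insert_subset hzD hED, ?_⟩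
    rw [Finset.card_insert_of_notMem hy]
    omega
  | succ m ih =>
    obtain ⟨Z, hZY, hZ⟩ := Finset.exists_subset_card_eq (s := Y) (n := (Y.card + 1) / 2)
      (by have := hne.card_pos; omega)
    have hZne : Z.Nonempty := Finset.card_pos.1 (by have := hne.card_pos; omega)
    have hsd := Finset.card_sdiff_of_subset hZY
    have hZE := hYE.mono_left hZY
    rw [pow_succ] at hY
    refine ⟨Z, fun b => ?_⟩
    cases b with
    | true =>
      refine (ih (by omega) hZE hZne).mono ?_
      rintro D ⟨⟨hED, hc, -⟩, hb⟩
      exact ⟨hED, hc, of_decide_eq_true hb⟩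
    | false =>
      have hsub : ∀ D : Finset α, (D ∩ Y).Nonempty → ¬ (D ∩ Z).Nonempty →
          (D ∩ (Y \ Z)).Nonempty := by
        rintro D ⟨z, hz⟩ hDZ
        have hz' := Finset.mem_inter.1 hz
        refine ⟨z, Finset.mem_inter.2 ⟨hz'.1, Finset.mem_sdiff.2 ⟨hz'.2, fun h => ?_⟩⟩⟩
        exact hDZ ⟨z, Finset.mem_inter.2 ⟨hz'.1, h⟩⟩
      by_cases hne' : (Y \ Z).Nonempty
      · refine (ih (by omega) (hYE.mono_left Finset.sdiff_subset) hne').mono ?_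
        rintro D ⟨⟨hED, hc, hDY⟩, hb⟩
        exact ⟨hED, hc, hsub D hDY (of_decide_eq_false hb)⟩
      · refine (ih (by omega) hZE hZne).mono ?_
        rintro D ⟨⟨-, -, hDY⟩, hb⟩
        exact absurd ((hsub D hDY (of_decide_eq_false hb)).mono Finset.inter_subset_right) hne'

/-- Repeated binary search: `k` unknown defective items are found by `k * c` tests when there are
at most `2 ^ c` items. -/
theorem Resolvable.of_card_le {α : Type*} [DecidableEq α] [Fintype α] {c : ℕ}
    (hc : Fintype.card α ≤ 2 ^ c) (k : ℕ) (E : Finset α) :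
    Resolvable (k * c) {D | E ⊆ D ∧ D.card = E.card + k} := by
  induction k generalizing E with
  | zero =>
    rw [Nat.zero_mul]
    rintro D ⟨hD, hDc⟩ D' ⟨hD', hDc'⟩
    exact (Finset.eq_of_subset_of_card_le hD hDc.le).symm.trans
      (Finset.eq_of_subset_of_card_le hD' hDc'.le)
  | succ k ih =>
    have hex : ∀ D : Finset α, E ⊆ D → D.card = E.card + (k + 1) → (D ∩ Eᶜ).Nonempty := by
      intro D _ hDc
      obtain ⟨x, hx, hxE⟩ := Finset.exists_mem_notMem_of_card_lt_card
        (show E.card < D.card by omega)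
      exact ⟨x, Finset.mem_inter.2 ⟨hx, Finset.mem_compl.2 hxE⟩⟩
    rw [Nat.succ_mul]
    by_cases hne : Eᶜ.Nonempty
    · refine (Resolvable.binary_search (k := k) (fun y _ => ih (insert y E)) c
        ((Finset.card_le_univ _).trans hc) disjoint_compl_left hne).mono ?_
      rintro D ⟨hED, hDc⟩
      exact ⟨hED, hDc, hex D hED hDc⟩
    · have hempty : {D | E ⊆ D ∧ D.card = E.card + (k + 1)} = (∅ : Set (Finset α)) := by
        refine Set.eq_empty_of_forall_notMem ?_
        rintro D ⟨hED, hDc⟩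
        exact hne ((hex D hED hDc).mono Finset.inter_subset_right)
      rw [hempty]
      exact Resolvable.empty _

/-- The members of `F` consistent with the first `n` of the answers `b`, when the `i`-th test is
chosen by `τ i` from the family that is still consistent. -/
def consistentFamily {α : Type*} [DecidableEq α] (τ : ℕ → Set (Finset α) → Finset α)
    (F : Set (Finset α)) (b : ℕ → Bool) : ℕ → Set (Finset α)
  | 0 => F
  | n + 1 => {D ∈ consistentFamily τ F b n |
      decide (D ∩ τ n (consistentFamily τ F b n)).Nonempty = b n}

theorem consistentFamily_congr {α : Type*} [DecidableEq α] (τ : ℕ → Set (Finset α) → Finset α)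
    (F : Set (Finset α)) {b b' : ℕ → Bool} {n : ℕ} (h : ∀ i < n, b i = b' i) :
    consistentFamily τ F b n = consistentFamily τ F b' n := by
  induction n with
  | zero => rfl
  | succ n ih =>
    simp only [consistentFamily, ih fun i hi => h i (hi.trans n.lt_succ_self), h n n.lt_succ_self]

/-- A family resolved by `T` adaptive tests is decoded by an adaptive strategy with `T` tests. -/
theorem Resolvable.exists_strategy {N T : ℕ} {F : Set (Finset (Fin N))} (hF : Resolvable T F) :
    ∃ (f : (i : Fin T) → ((j : Fin T) → j < i → Bool) → Finset (Fin N))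
      (g : (Fin T → Bool) → Finset (Fin N)), ∀ D ∈ F, g (answers f D) = D := by
  classical
  have hτ : ∀ (n : ℕ) (G : Set (Finset (Fin N))), ∃ S : Finset (Fin N), Resolvable (n + 1) G →
      ∀ b : Bool, Resolvable n {D ∈ G | decide (D ∩ S).Nonempty = b} := by
    intro n G
    by_cases h : Resolvable (n + 1) G
    · obtain ⟨S, hS⟩ := h
      exact ⟨S, fun _ => hS⟩
    · exact ⟨∅, fun h' => absurd h' h⟩
  choose τ hτ using hτ
  let C := consistentFamily (fun n => τ (T - (n + 1))) F
  have hC : ∀ (b : ℕ → Bool) (n : ℕ), n ≤ T → Resolvable (T - n) (C b n) := by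
    intro b n
    induction n with
    | zero => exact fun _ => hF
    | succ n ih =>
      intro hn
      refine hτ (T - (n + 1)) _ ?_ (b n)
      rw [show T - (n + 1) + 1 = T - n by omega]
      exact ih (by omega)
  let ext : (Fin T → Bool) → ℕ → Bool := fun a i => if h : i < T then a ⟨i, h⟩ else false
  let f : (i : Fin T) → ((j : Fin T) → j < i → Bool) → Finset (Fin N) := fun i p =>
    τ (T - (i + 1)) (C (ext fun j => if h : j < i then p j h else false) i)
  have hmem : ∀ D ∈ F, ∀ n ≤ T, D ∈ C (ext (answers f D)) n := by
    intro D hD n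
    induction n with
    | zero => exact fun _ => hD
    | succ n ih =>
      intro hn
      refine ⟨ih (by omega), ?_⟩
      have hans : ext (answers f D) n = answers f D ⟨n, hn⟩ := dif_pos hn
      have hpast : C (ext fun j => if j < ⟨n, hn⟩ then answers f D j else false) n =
          C (ext (answers f D)) n := by
        refine consistentFamily_congr _ _ fun i hi => ?_
        have hiT : i < T := by omega
        simp [ext, hiT, hi]
      rw [hans, answers]
      change _ = decide (D ∩ τ (T - (n + 1))
        (C (ext fun j => if j < ⟨n, hn⟩ then answers f D j else false) n)).Nonempty
      rw [hpast]
  refine ⟨f, fun a => if h : (C (ext a) T).Nonempty then h.some else ∅, fun D hD => ?_⟩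
  have hDT := hmem D hD T le_rfl
  have hsub : (C (ext (answers f D)) T).Subsingleton := by
    have := hC (ext (answers f D)) T le_rfl
    rwa [Nat.sub_self] at this
  have hne : (C (ext (answers f D)) T).Nonempty := ⟨D, hDT⟩
  simp only [dif_pos hne]
  exact hsub hne.some_mem hDT

/-- Theorem 2.2: Repeated Binary Testing recovers any defective set of size `K` among
`N` items with certainty using `K⌈log₂ N⌉` adaptive tests. -/
theorem repeated_binary_testing (N K : ℕ) (hN : 1 ≤ N) (hKN : K ≤ N) :
    ∃ (f : (i : Fin (K * Nat.clog 2 N)) →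
          ((j : Fin (K * Nat.clog 2 N)) → j < i → Bool) → Finset (Fin N))
      (g : (Fin (K * Nat.clog 2 N) → Bool) → Finset (Fin N)),
      ∀ D : Finset (Fin N), D.card = K → g (answers f D) = D := by
  have hR := Resolvable.of_card_le (α := Fin N) (c := Nat.clog 2 N)
    (by simpa using Nat.le_pow_clog one_lt_two N) K ∅
  obtain ⟨f, g, h⟩ := hR.exists_strategy
  exact ⟨f, g, fun D hD => h D ⟨Finset.empty_subset D, by simpa using hD⟩⟩
end

section
/- Let K : ℕ → ℕ satisfy 1 ≤ K(N) ≤ N for all N ≥ 1 and (K(N) : ℝ)/N → 0 as N → ∞, and let ε > 0. Suppose for each N we are given an adaptive group testing strategy f_N with T(N) tests on Fin N and a decoder g_N, such that (1 + ε) · T(N) ≤ log₂(N choose K(N)) for all sufficiently large N. Then the fraction of correctly recovered defective sets, namely |{D : Finset (Fin N) | D.card = K(N) ∧ g_N (a(D)) = D}| / (N choose K(N)), tends to 0 as N → ∞. (Converse half of Theorem 1.2: any sequence of adaptive algorithms with rate at least 1 + ε has success probability, for a uniformly random defective set, tending to 0.) -/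
open Filter

/-- A decoder recovers at most `2 ^ T` defective sets from `T` binary answers. -/
theorem card_filter_recovered_le {N T : ℕ}
    (f : (i : Fin T) → ((j : Fin T) → j < i → Bool) → Finset (Fin N))
    (g : (Fin T → Bool) → Finset (Fin N)) (k : ℕ) :
    (Finset.univ.filter
      (fun D : Finset (Fin N) => D.card = k ∧ g (answers f D) = D)).card ≤ 2 ^ T := by
  have h := Finset.card_le_card_of_injOn (t := (Finset.univ : Finset (Fin T → Bool)))
    (s := Finset.univ.filter
      (fun D : Finset (Fin N) => D.card = k ∧ g (answers f D) = D)) (answers f)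
    (fun _ _ => Finset.mem_coe.2 (Finset.mem_univ _)) (by
      intro D hD E hE hDE
      have hD' := (Finset.mem_filter.1 (Finset.mem_coe.1 hD)).2.2
      have hE' := (Finset.mem_filter.1 (Finset.mem_coe.1 hE)).2.2
      rw [← hD', ← hE', hDE])
  simpa using h

theorem le_mul_choose {n k : ℕ} (hk : 1 ≤ k) (hkn : k ≤ n) : n ≤ k * n.choose k := by
  obtain ⟨k, rfl⟩ := Nat.exists_eq_add_of_le' hk
  obtain ⟨n, rfl⟩ := Nat.exists_eq_add_of_le' (hk.trans hkn)
  rw [mul_comm (k + 1), ← Nat.add_one_mul_choose_eq]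
  exact Nat.le_mul_of_pos_right _ (Nat.choose_pos (by omega))

theorem two_pow_div_le_rpow_neg {ε C : ℝ} (hε : 0 < ε) (hC : 0 < C) {T : ℕ}
    (h : (1 + ε) * (T : ℝ) ≤ Real.logb 2 C) :
    2 ^ T / C ≤ C ^ (-(ε / (1 + ε))) := by
  have h1 : (T : ℝ) ≤ Real.logb 2 C * (1 / (1 + ε)) := by
    rw [mul_one_div, le_div_iff₀ (by positivity)]
    linarith
  have h2 : (2 : ℝ) ^ T ≤ C ^ (1 / (1 + ε)) := by
    calc (2 : ℝ) ^ T = 2 ^ (T : ℝ) := (Real.rpow_natCast 2 T).symm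
      _ ≤ 2 ^ (Real.logb 2 C * (1 / (1 + ε))) :=
          Real.rpow_le_rpow_of_exponent_le one_le_two h1
      _ = C ^ (1 / (1 + ε)) := by
          rw [Real.rpow_mul zero_le_two, Real.rpow_logb two_pos (by norm_num) hC]
  have h3 : -(ε / (1 + ε)) = 1 / (1 + ε) - 1 := by
    field_simp
    ring
  rw [h3, Real.rpow_sub_one hC.ne']
  gcongr

/-- Converse half of Theorem 1.2: in any regime with `1 ≤ K(N) ≤ N` and `K(N)/N → 0`,
any sequence of adaptive algorithms whose rate is at least `1 + ε` has success
probability (for a uniformly random defective set of size `K(N)`) tending to `0`. -/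
theorem converse_success_prob_tendsto_zero (K : ℕ → ℕ)
    (hK : ∀ N : ℕ, 1 ≤ N → 1 ≤ K N ∧ K N ≤ N)
    (hKo : Tendsto (fun N : ℕ => (K N : ℝ) / (N : ℝ)) atTop (nhds 0))
    (ε : ℝ) (hε : 0 < ε) (T : ℕ → ℕ)
    (f : (N : ℕ) → (i : Fin (T N)) → ((j : Fin (T N)) → j < i → Bool) → Finset (Fin N))
    (g : (N : ℕ) → (Fin (T N) → Bool) → Finset (Fin N))
    (hT : ∀ᶠ N : ℕ in atTop, (1 + ε) * (T N : ℝ) ≤ Real.logb 2 (N.choose (K N) : ℝ)) :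
    Tendsto (fun N : ℕ =>
        ((Finset.univ.filter
            (fun D : Finset (Fin N) => D.card = K N ∧ g N (answers (f N) D) = D)).card : ℝ)
          / (N.choose (K N) : ℝ))
      atTop (nhds 0) := by
  have hδ : 0 < ε / (1 + ε) := by positivity
  have hlim : Tendsto (fun N : ℕ => ((K N : ℝ) / (N : ℝ)) ^ (ε / (1 + ε))) atTop (nhds 0) := by
    simpa [Real.zero_rpow hδ.ne'] using hKo.rpow_const (Or.inr hδ.le)
  refine squeeze_zero' (Eventually.of_forall fun N => by positivity) ?_ hlim
  filter_upwards [hT, eventually_ge_atTop 1] with N hTN hN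
  obtain ⟨hK1, hKN⟩ := hK N hN
  have hC : (0 : ℝ) < N.choose (K N) := by exact_mod_cast Nat.choose_pos hKN
  have hN0 : (0 : ℝ) < N := by exact_mod_cast hN
  have hle : (N : ℝ) ≤ K N * N.choose (K N) := by exact_mod_cast le_mul_choose hK1 hKN
  calc _ ≤ (2 : ℝ) ^ T N / N.choose (K N) := by
        gcongr
        exact_mod_cast card_filter_recovered_le (f N) (g N) (K N)
    _ ≤ (N.choose (K N) : ℝ) ^ (-(ε / (1 + ε))) := two_pow_div_le_rpow_neg hε hC hTN
    _ = ((N.choose (K N) : ℝ)⁻¹) ^ (ε / (1 + ε)) := by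
        rw [Real.rpow_neg hC.le, Real.inv_rpow hC.le]
    _ ≤ ((K N : ℝ) / (N : ℝ)) ^ (ε / (1 + ε)) := by
        refine Real.rpow_le_rpow (by positivity) ?_ hδ.le
        rw [inv_eq_one_div, div_le_div_iff₀ hC hN0]
        linarith
end

section
/- Let K : ℕ → ℕ satisfy 1 ≤ K(N) ≤ N for all N ≥ 1 and (K(N) : ℝ)/N → 0 as N → ∞. Then there exist T : ℕ → ℕ and, for each N, an adaptive group testing strategy f_N with T(N) tests on Fin N and a decoder g_N, such that g_N (a(D)) = D for every D : Finset (Fin N) with D.card = K(N), and such that log₂(N choose K(N)) / T(N) → 1 as N → ∞. (Achievability half of Theorem 1.2: there is a sequence of adaptive algorithms with success probability 1 whose rate tends to 1, so the capacity of noiseless adaptive group testing is 1 when K = o(N).) -/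
open Filter

/-- A family `S` of defective sets is identifiable with `T` tests if some adaptive strategy
with `T` tests, together with some decoder, succeeds on every member of `S`. -/
def Identifiable {N : ℕ} (S : Set (Finset (Fin N))) (T : ℕ) : Prop :=
  ∃ (f : (i : Fin T) → ((j : Fin T) → j < i → Bool) → Finset (Fin N))
    (g : (Fin T → Bool) → Finset (Fin N)), ∀ D ∈ S, g (answers f D) = D

namespace Identifiable

variable {N : ℕ} {S S' : Set (Finset (Fin N))} {T T' : ℕ}

theorem mono (h : Identifiable S T) (hS : S' ⊆ S) : Identifiable S' T := by
  obtain ⟨f, g, hfg⟩ := h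
  exact ⟨f, g, fun D hD => hfg D (hS hD)⟩

theorem of_subsingleton (hS : S.Subsingleton) : Identifiable S 0 := by
  rcases hS.eq_empty_or_singleton with rfl | ⟨D₀, rfl⟩
  · exact ⟨fun i _ => i.elim0, fun _ => ∅, by simp⟩
  · exact ⟨fun i _ => i.elim0, fun _ => D₀, by simp⟩

/-- The strategy which first tests `A` and then follows `f b` when the answer is `b`. -/
def branchStrategy (A : Finset (Fin N))
    (f : Bool → (i : Fin T) → ((j : Fin T) → j < i → Bool) → Finset (Fin N)) :
    (i : Fin (T + 1)) → ((j : Fin (T + 1)) → j < i → Bool) → Finset (Fin N) :=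
  Fin.cases (fun _ => A) fun i a =>
    f (a 0 i.succ_pos) i fun j hj => a j.succ (Fin.succ_lt_succ_iff.mpr hj)

theorem answers_branchStrategy_zero (A : Finset (Fin N))
    (f : Bool → (i : Fin T) → ((j : Fin T) → j < i → Bool) → Finset (Fin N))
    (D : Finset (Fin N)) :
    answers (branchStrategy A f) D 0 = decide (D ∩ A).Nonempty := by
  rw [answers]
  rfl

theorem answers_branchStrategy_succ (A : Finset (Fin N))
    (f : Bool → (i : Fin T) → ((j : Fin T) → j < i → Bool) → Finset (Fin N))
    (D : Finset (Fin N)) (i : Fin T) :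
    answers (branchStrategy A f) D i.succ = answers (f (decide (D ∩ A).Nonempty)) D i := by
  induction i using WellFoundedLT.induction with
  | ind i ih =>
    have hf : branchStrategy A f i.succ (fun j _ => answers (branchStrategy A f) D j) =
        f (decide (D ∩ A).Nonempty) i
          (fun j _ => answers (f (decide (D ∩ A).Nonempty)) D j) := by
      change f (answers (branchStrategy A f) D 0) i
        (fun j _ => answers (branchStrategy A f) D j.succ) = _
      rw [answers_branchStrategy_zero]
      congr 1
      funext j hj
      exact ih j hj
    rw [answers, answers, hf]

theorem branch (A : Finset (Fin N))
    (hpos : Identifiable (S ∩ {D | (D ∩ A).Nonempty}) T)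
    (hneg : Identifiable (S ∩ {D | ¬(D ∩ A).Nonempty}) T) : Identifiable S (T + 1) := by
  obtain ⟨f₁, g₁, h₁⟩ := hpos
  obtain ⟨f₂, g₂, h₂⟩ := hneg
  refine ⟨branchStrategy A fun b => if b then f₁ else f₂,
    fun a => (if a 0 then g₁ else g₂) fun i => a i.succ, fun D hD => ?_⟩
  simp only [answers_branchStrategy_succ, answers_branchStrategy_zero]
  by_cases hA : (D ∩ A).Nonempty
  · simpa [hA] using h₁ D ⟨hD, hA⟩
  · simpa [hA] using h₂ D ⟨hD, hA⟩

theorem mono_right (h : Identifiable S T) (hT : T ≤ T') : Identifiable S T' := by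
  induction T', hT using Nat.le_induction with
  | base => exact h
  | succ n _ ih =>
    exact branch ∅ (ih.mono Set.inter_subset_left) (ih.mono Set.inter_subset_left)

/-- Binary search: if every member of `S` meets `U`, then `a` tests suffice to find a
defective item of `U` when `U` has at most `2 ^ a` elements. -/
theorem binary_search (a : ℕ) (U : Finset (Fin N)) (hU : U.card ≤ 2 ^ a)
    (hS : ∀ D ∈ S, (D ∩ U).Nonempty)
    (hx : ∀ x ∈ U, Identifiable (S ∩ {D | x ∈ D}) T) : Identifiable S (T + a) := by
  induction a generalizing S U with
  | zero =>
    rcases U.eq_empty_or_nonempty with rfl | ⟨x, hxU⟩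
    · refine (of_subsingleton fun D hD => ?_).mono_right (Nat.zero_le _)
      simpa using hS D hD
    · refine (hx x hxU).mono fun D hD => ⟨hD, ?_⟩
      obtain ⟨y, hy⟩ := hS D hD
      rw [Finset.mem_inter] at hy
      rw [Set.mem_ofPred_eq, ← Finset.card_le_one.mp hU y hy.2 x hxU]
      exact hy.1
  | succ a ih =>
    obtain ⟨A, hAU, hA⟩ := Finset.exists_subset_card_eq (Nat.min_le_right (2 ^ a) U.card)
    refine branch A (ih A (hA.trans_le (min_le_left _ _)) (fun D hD => hD.2) fun x hxA => ?_)
      (ih (U \ A) ?_ (fun D hD => ?_) fun x hxA => ?_)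
    · exact (hx x (hAU hxA)).mono fun D hD => ⟨hD.1.1, hD.2⟩
    · rw [Finset.card_sdiff_of_subset hAU, hA]
      rw [pow_succ] at hU
      omega
    · obtain ⟨y, hy⟩ := hS D hD.1
      rw [Finset.mem_inter] at hy
      refine ⟨y, Finset.mem_inter.mpr ⟨hy.1, Finset.mem_sdiff.mpr ⟨hy.2, fun hyA => ?_⟩⟩⟩
      exact hD.2 ⟨y, Finset.mem_inter.mpr ⟨hy.1, hyA⟩⟩
    · exact (hx x (Finset.sdiff_subset hxA)).mono fun D hD => ⟨hD.1.1, hD.2⟩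

/-- Generalized binary splitting: if the members of `S` agree outside `R` and contain at most
`k` elements of `R`, test groups of `2 ^ a` items of `R`, discarding a group with a negative
answer and finding a defective item by binary search in a group with a positive answer. -/
theorem binary_splitting (a k n : ℕ) (R D₀ : Finset (Fin N)) (hR : R.card ≤ n * 2 ^ a)
    (hD₀ : ∀ D ∈ S, D \ R = D₀) (hk : ∀ D ∈ S, (D ∩ R).card ≤ k) :
    Identifiable S (n + k * (a + 1)) := by
  induction k generalizing n R D₀ S with
  | zero =>
    refine (of_subsingleton fun D hD D' hD' => ?_).mono_right (Nat.zero_le _)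
    have key : ∀ E ∈ S, E = D₀ := fun E hE => by
      rw [← hD₀ E hE, eq_comm, Finset.sdiff_eq_self_iff_disjoint,
        Finset.disjoint_iff_inter_eq_empty, ← Finset.card_eq_zero]
      exact Nat.le_zero.mp (hk E hE)
    rw [key D hD, key D' hD']
  | succ k ihk =>
    induction n generalizing R D₀ S with
    | zero =>
      refine (of_subsingleton fun D hD D' hD' => ?_).mono_right (Nat.zero_le _)
      obtain rfl : R = ∅ := by simpa using hR
      simpa using (hD₀ D hD).trans (hD₀ D' hD').symm
    | succ n ihn =>
      obtain ⟨U, hUR, hU⟩ := Finset.exists_subset_card_eq (Nat.min_le_right (2 ^ a) R.card)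
      have hT : n + 1 + (k + 1) * (a + 1) = n + 1 + k * (a + 1) + a + 1 := by ring
      rw [hT]
      refine branch U (binary_search a U (hU.trans_le (min_le_left _ _)) (fun D hD => hD.2)
        fun x hxU => ?_) ?_
      · refine ihk (n + 1) (R.erase x) (insert x D₀) ((Finset.card_erase_le).trans hR)
          (fun D hD => ?_) fun D hD => ?_
        · rw [← hD₀ D hD.1.1, Finset.sdiff_erase hD.2]
        · have hxR : x ∈ D ∩ R := Finset.mem_inter.mpr ⟨hD.2, hUR hxU⟩
          rw [Finset.inter_erase, Finset.card_erase_of_mem hxR]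
          exact Nat.sub_le_of_le_add (hk D hD.1.1)
      · have hcard : (R \ U).card ≤ n * 2 ^ a := by
          rw [Finset.card_sdiff_of_subset hUR, hU]
          rw [add_mul, one_mul] at hR
          omega
        refine (ihn (R \ U) D₀ hcard (fun D hD => ?_) fun D hD => ?_).mono_right (by lia)
        · rw [← hD₀ D hD.1]
          ext y
          have hy : y ∈ D → y ∉ U := fun hyD hyU =>
            hD.2 ⟨y, Finset.mem_inter.mpr ⟨hyD, hyU⟩⟩
          simp only [Finset.mem_sdiff]
          tauto
        · exact (Finset.card_le_card
            (Finset.inter_subset_inter_left Finset.sdiff_subset)).trans (hk D hD.1)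

theorem of_card_eq (k a : ℕ) (h : N ≤ k * 2 ^ a) :
    Identifiable {D : Finset (Fin N) | D.card = k} (k * (a + 2)) := by
  have key := binary_splitting (S := {D : Finset (Fin N) | D.card = k}) a k k Finset.univ ∅
    (by simpa using h) (by simp) (by simp +contextual)
  rwa [show k + k * (a + 1) = k * (a + 2) by ring] at key

end Identifiable

/-- The counting bound: a strategy succeeding on all sets of size `k` uses at least
`log₂ (N choose k)` tests. -/
theorem Identifiable.choose_le_two_pow {N k T : ℕ}
    (h : Identifiable {D : Finset (Fin N) | D.card = k} T) : N.choose k ≤ 2 ^ T := by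
  obtain ⟨f, g, hfg⟩ := h
  have hinj : Set.InjOn (answers f) (Finset.powersetCard k (Finset.univ : Finset (Fin N))) := by
    intro D hD D' hD' hDD'
    rw [Finset.mem_coe, Finset.mem_powersetCard_univ] at hD hD'
    rw [← hfg D hD, ← hfg D' hD', hDD']
  simpa using Finset.card_le_card_of_injOn (t := Finset.univ) (answers f) (by simp) hinj

theorem div_pow_le_choose {n k : ℕ} (h : k ≤ n) : ((n : ℝ) / k) ^ k ≤ n.choose k := by
  induction k generalizing n with
  | zero => simp
  | succ k ih =>
    obtain ⟨m, rfl⟩ : ∃ m, n = m + 1 := ⟨n - 1, by omega⟩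
    have hkm : k ≤ m := by omega
    have hchoose : ((m + 1).choose (k + 1) : ℝ) = (m + 1) / (k + 1) * m.choose k := by
      rw [div_mul_eq_mul_div, eq_div_iff (by positivity)]
      exact_mod_cast (Nat.add_one_mul_choose_eq m k).symm
    have hpow : (((m : ℝ) + 1) / (k + 1)) ^ k ≤ ((m : ℝ) / k) ^ k := by
      rcases Nat.eq_zero_or_pos k with rfl | hk
      · simp
      · have hkm' : (k : ℝ) ≤ m := by exact_mod_cast hkm
        have hk' : (0 : ℝ) < k := by exact_mod_cast hk
        gcongr ?_ ^ k
        rw [div_le_div_iff₀ (by positivity) hk']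
        linarith
    rw [hchoose, pow_succ']
    push_cast
    gcongr
    exact hpow.trans (ih hkm)

/-- Achievability half of Theorem 1.2: in any regime with `1 ≤ K(N) ≤ N` and
`K(N)/N → 0`, there is a sequence of adaptive algorithms which always recover the
defective set and whose rate tends to `1`. -/
theorem achievability_rate_tendsto_one (K : ℕ → ℕ)
    (hK : ∀ N : ℕ, 1 ≤ N → 1 ≤ K N ∧ K N ≤ N)
    (hKo : Tendsto (fun N : ℕ => (K N : ℝ) / (N : ℝ)) atTop (nhds 0)) :
    ∃ (T : ℕ → ℕ)
      (f : (N : ℕ) → (i : Fin (T N)) → ((j : Fin (T N)) → j < i → Bool) → Finset (Fin N))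
      (g : (N : ℕ) → (Fin (T N) → Bool) → Finset (Fin N)),
      (∀ (N : ℕ) (D : Finset (Fin N)), D.card = K N → g N (answers (f N) D) = D) ∧
      Tendsto (fun N : ℕ => Real.logb 2 (N.choose (K N) : ℝ) / (T N : ℝ)) atTop (nhds 1) := by
  have hL : Tendsto (fun N : ℕ => Real.logb 2 ((N : ℝ) / K N)) atTop atTop := by
    refine (Real.tendsto_logb_atTop one_lt_two).comp ?_
    have hKo' : Tendsto (fun N : ℕ => (K N : ℝ) / (N : ℝ)) atTop (nhdsWithin 0 (Set.Ioi 0)) := by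
      refine tendsto_nhdsWithin_iff.mpr ⟨hKo, ?_⟩
      filter_upwards [eventually_ge_atTop 1] with N hN
      have h1 : (0 : ℝ) < K N := by exact_mod_cast (hK N hN).1
      have h2 : (0 : ℝ) < N := by exact_mod_cast hN
      exact div_pos h1 h2
    exact hKo'.inv_tendsto_nhdsGT_zero.congr fun N => inv_div _ _
  set a : ℕ → ℕ := fun N => ⌈Real.logb 2 ((N : ℝ) / K N)⌉₊
  have hNa : ∀ N : ℕ, N ≤ K N * 2 ^ a N := by
    intro N
    rcases Nat.eq_zero_or_pos N with rfl | hN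
    · exact Nat.zero_le _
    have h1 : (0 : ℝ) < K N := by exact_mod_cast (hK N hN).1
    have h2 : (0 : ℝ) < N := by exact_mod_cast hN
    have h3 : (N : ℝ) / K N ≤ 2 ^ a N := by
      rw [← Real.rpow_natCast, ← Real.logb_le_iff_le_rpow one_lt_two (div_pos h2 h1)]
      exact Nat.le_ceil _
    rw [div_le_iff₀' h1] at h3
    exact_mod_cast h3
  have hid := fun N => Identifiable.of_card_eq (K N) (a N) (hNa N)
  choose f g hfg using fun N => hid N
  refine ⟨fun N => K N * (a N + 2), f, g, hfg, ?_⟩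
  have hlower : Tendsto (fun N : ℕ => 1 - 3 / (Real.logb 2 ((N : ℝ) / K N) + 3)) atTop
      (nhds 1) := by
    simpa using (tendsto_const_nhds (x := (1 : ℝ))).sub
      ((tendsto_const_nhds (x := (3 : ℝ))).div_atTop (tendsto_atTop_add_const_right _ 3 hL))
  refine tendsto_of_tendsto_of_tendsto_of_le_of_le' hlower tendsto_const_nhds ?_ ?_
  · filter_upwards [eventually_ge_atTop 1, hL.eventually_ge_atTop 0] with N hN hLN
    obtain ⟨hK1, hKN⟩ := hK N hN
    have h1 : (0 : ℝ) < K N := by exact_mod_cast hK1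
    have h2 : (0 : ℝ) < N := by exact_mod_cast hN
    have hlog : K N * Real.logb 2 ((N : ℝ) / K N) ≤ Real.logb 2 (N.choose (K N)) := by
      rw [← Real.logb_pow]
      exact Real.logb_le_logb_of_le one_lt_two (by positivity) (div_pow_le_choose hKN)
    have haN : (a N : ℝ) < Real.logb 2 ((N : ℝ) / K N) + 1 := Nat.ceil_lt_add_one hLN
    set L := Real.logb 2 ((N : ℝ) / K N)
    have hrw : 1 - 3 / (L + 3) = K N * L / (K N * (L + 3)) := by
      field_simp
      ring
    rw [hrw]
    push_cast
    have hL3 : (a N : ℝ) + 2 ≤ L + 3 := by linarith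
    have h3 : 0 ≤ K N * L := by positivity
    exact div_le_div₀ (h3.trans hlog) hlog (by positivity) (by gcongr)
  · filter_upwards [eventually_ge_atTop 1] with N hN
    refine div_le_one_of_le₀ ?_ (Nat.cast_nonneg _)
    have h1 : (0 : ℝ) < N.choose (K N) := by
      exact_mod_cast Nat.choose_pos (hK N hN).2
    rw [Real.logb_le_iff_le_rpow one_lt_two h1, Real.rpow_natCast]
    exact_mod_cast (hid N).choose_le_two_pow
end

section
/- Let n, k, b be natural numbers with k ≥ 1, n ≥ 1 and b ≤ n. If (b : ℝ) ≥ n · (1 − 2^{−1/k}), then 2 · ((n − b) choose k) ≤ n choose k; equivalently, if a set of n items contains k defectives and a subset of size b is chosen uniformly at random, the probability ((n−b) choose k)/(n choose k) that the subset contains no defective item is at most 1/2. (Lemma 4.2, stated precisely: choosing the test size at least n(1 − 2^{−1/k}) makes the probability of a negative test at most 1/2.) -/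
theorem Nat.pow_mul_descFactorial_le_pow_mul_descFactorial {m n : ℕ} (hmn : m ≤ n) (k : ℕ) :
    n ^ k * m.descFactorial k ≤ m ^ k * n.descFactorial k := by
  rw [Nat.descFactorial_eq_prod_range, Nat.descFactorial_eq_prod_range,
    Finset.pow_eq_prod_const, Finset.pow_eq_prod_const, ← Finset.prod_mul_distrib,
    ← Finset.prod_mul_distrib]
  refine Finset.prod_le_prod' fun i _ => ?_
  rw [Nat.mul_sub, Nat.mul_sub, Nat.mul_comm n m]
  exact Nat.sub_le_sub_left (Nat.mul_le_mul_right i hmn) _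

theorem Nat.pow_mul_choose_le_pow_mul_choose {m n : ℕ} (hmn : m ≤ n) (k : ℕ) :
    n ^ k * m.choose k ≤ m ^ k * n.choose k := by
  have h := Nat.pow_mul_descFactorial_le_pow_mul_descFactorial hmn k
  rw [Nat.descFactorial_eq_factorial_mul_choose, Nat.descFactorial_eq_factorial_mul_choose,
    Nat.mul_left_comm, Nat.mul_left_comm (m ^ k)] at h
  exact Nat.le_of_mul_le_mul_left h k.factorial_pos

/-- Lemma 4.2: if a test of size `b ≥ n(1 − 2^{−1/k})` is chosen from `n` items
containing `k` defectives, the probability `((n−b) choose k)/(n choose k)` that the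
test is negative is at most `1/2`; equivalently `2 ((n−b) choose k) ≤ n choose k`. -/
theorem test_negative_prob_le_half (n k b : ℕ) (hk : 1 ≤ k) (hn : 1 ≤ n) (hb : b ≤ n)
    (h : (n : ℝ) * (1 - (2 : ℝ) ^ (-1 / (k : ℝ))) ≤ (b : ℝ)) :
    2 * (n - b).choose k ≤ n.choose k := by
  have hroot : ((2 : ℝ) ^ (-1 / (k : ℝ))) ^ k = 1 / 2 := by
    have hk0 : (k : ℝ) ≠ 0 := by positivity
    rw [← Real.rpow_mul_natCast (by norm_num), div_mul_cancel₀ _ hk0, Real.rpow_neg_one]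
    norm_num
  have hle : ((n - b : ℕ) : ℝ) ≤ n * (2 : ℝ) ^ (-1 / (k : ℝ)) := by
    rw [Nat.cast_sub hb]
    linarith
  have hpow : 2 * (n - b) ^ k ≤ n ^ k := by
    have hreal := pow_le_pow_left₀ (Nat.cast_nonneg _) hle k
    rw [mul_pow, hroot] at hreal
    have : (2 : ℝ) * ((n - b : ℕ) : ℝ) ^ k ≤ (n : ℝ) ^ k := by linarith
    exact_mod_cast this
  refine Nat.le_of_mul_le_mul_left ?_ (pow_pos hn k)
  calc n ^ k * (2 * (n - b).choose k) = 2 * (n ^ k * (n - b).choose k) := Nat.mul_left_comm ..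
    _ ≤ 2 * ((n - b) ^ k * n.choose k) :=
      Nat.mul_le_mul_left 2 (Nat.pow_mul_choose_le_pow_mul_choose (Nat.sub_le n b) k)
    _ = 2 * (n - b) ^ k * n.choose k := (Nat.mul_assoc ..).symm
    _ ≤ n ^ k * n.choose k := Nat.mul_le_mul_right _ hpow
end
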